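/- arXiv:2306.06766 — 3 statements merged into one kernel-verified Lean document; each statement's English description precedes it below -/
import Mathlib

section
/- Let E be the Euclidean plane (EuclideanSpace ℝ (Fin 2)), Ω ⊆ E, and x* ∈ E. Let H ≥ 1 and let p : Fin (H+1) → E be a polygonal navigation path with p H = x*. Suppose there are indices j < i ≤ H such that p j has line of sight to x* (segment ℝ (p j) x* ⊆ Ω) while p i does not (¬ (segment ℝ (p i) x* ⊆ Ω)). Then the tail of the path from p j to the target is strictly longer than the straight line: ∑_{t=j}^{H−1} dist (p t) (p (t+1)) > dist (p j) x*. In particular, replacing the tail by the straight segment from p j to x* (which lies in Ω) yields a strictly shorter path, so the original path is not a shortest path. -/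
/-- The polygonal inequality for a finite path indexed by `Fin (n + 1)`. -/
theorem Fin.dist_le_sum_Ico_dist {X : Type*} [PseudoMetricSpace X] {n : ℕ}
    (p : Fin (n + 1) → X) {a b : Fin (n + 1)} (hab : a ≤ b) :
    dist (p a) (p b) ≤ ∑ t ∈ Finset.Ico a b, dist (p t) (p (t + 1)) := by
  induction b using Fin.induction with
  | zero =>
    obtain rfl : a = 0 := Fin.le_zero_iff.mp hab
    simp
  | succ k ih =>
    rcases hab.eq_or_lt with rfl | hlt
    · simp
    have hak : a ≤ k.castSucc := Fin.le_castSucc_iff.mpr hlt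
    have hIco : Finset.Ico a k.succ = insert k.castSucc (Finset.Ico a k.castSucc) := by
      ext t
      simp only [Finset.mem_Ico, Finset.mem_insert, Fin.le_def, Fin.lt_def, Fin.ext_iff,
        Fin.val_succ, Fin.val_castSucc] at hak ⊢
      omega
    rw [hIco, Finset.sum_insert (by simp), Fin.coeSucc_eq_succ, add_comm]
    exact (dist_triangle _ (p k.castSucc) _).trans (by gcongr; exact ih hak)

/-- If a polygonal path ending at the target `x*` has an LOS pose `p j` followed by
a non-LOS pose `p i` (`j < i`), then the tail of the path from `p j` is strictly
longer than the straight line from `p j` to `x*`; hence the path is not shortest. -/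
theorem los_increase_not_shortest (Ω : Set (EuclideanSpace ℝ (Fin 2)))
    (xstar : EuclideanSpace ℝ (Fin 2)) (H : ℕ) (hH : 1 ≤ H)
    (p : Fin (H + 1) → EuclideanSpace ℝ (Fin 2))
    (hend : p (Fin.last H) = xstar)
    (j i : Fin (H + 1)) (hji : j < i)
    (hLOS : segment ℝ (p j) xstar ⊆ Ω)
    (hNLOS : ¬ segment ℝ (p i) xstar ⊆ Ω) :
    ∑ t ∈ Finset.Ico j (Fin.last H), dist (p t) (p (t + 1)) > dist (p j) xstar := by
  have hi : i ≤ Fin.last H := Fin.le_last i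
  have hlt : dist (p j) xstar < dist (p j) (p i) + dist (p i) xstar := by
    refine (dist_triangle _ _ _).lt_of_ne fun h => hNLOS ?_
    have hmem : p i ∈ segment ℝ (p j) xstar :=
      mem_segment_iff_wbtw.mpr (dist_add_dist_eq_iff.mp h.symm)
    exact ((convex_segment _ _).segment_subset hmem (right_mem_segment ℝ _ _)).trans hLOS
  rw [← Finset.Ico_union_Ico_eq_Ico hji.le hi,
    Finset.sum_union (Finset.Ico_disjoint_Ico_consecutive _ _ _)]
  refine hlt.trans_le (add_le_add (Fin.dist_le_sum_Ico_dist p hji.le) ?_)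
  rw [← hend]
  exact Fin.dist_le_sum_Ico_dist p hi
end

section
/- Let E be the Euclidean plane (EuclideanSpace ℝ (Fin 2)), Ω ⊆ E, and x* ∈ E. Let p : Fin (H+1) → E be a feasible polygonal path with p H = x* (feasible meaning segment ℝ (p t) (p (t+1)) ⊆ Ω for every t < H). Suppose p is a shortest feasible path: for every m ≥ 1 and every feasible polygonal path q : Fin (m+1) → E with q 0 = p 0 and q m = x*, one has ∑_{t<H} dist (p t) (p (t+1)) ≤ ∑_{t<m} dist (q t) (q (t+1)). Then line of sight is monotone along the path: for all indices j ≤ i ≤ H, if p j has line of sight to x* (segment ℝ (p j) x* ⊆ Ω), then p i also has line of sight to x*. -/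
/-- Along a shortest feasible polygonal path to the target `x*`, line of sight is
monotone: once a pose has line of sight to the target, all later poses do too. -/
theorem shortest_path_los_monotone (Ω : Set (EuclideanSpace ℝ (Fin 2)))
    (xstar : EuclideanSpace ℝ (Fin 2)) (H : ℕ)
    (p : Fin (H + 1) → EuclideanSpace ℝ (Fin 2))
    (hfeas : ∀ t : Fin H, segment ℝ (p t.castSucc) (p t.succ) ⊆ Ω)
    (hend : p (Fin.last H) = xstar)
    (hshort : ∀ m : ℕ, 1 ≤ m → ∀ q : Fin (m + 1) → EuclideanSpace ℝ (Fin 2),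
      (∀ t : Fin m, segment ℝ (q t.castSucc) (q t.succ) ⊆ Ω) →
      q 0 = p 0 → q (Fin.last m) = xstar →
      ∑ t : Fin H, dist (p t.castSucc) (p t.succ) ≤
        ∑ t : Fin m, dist (q t.castSucc) (q t.succ)) :
    ∀ j i : Fin (H + 1), j ≤ i →
      segment ℝ (p j) xstar ⊆ Ω → segment ℝ (p i) xstar ⊆ Ω := by
  intro j i hji hlos
  set P : ℕ → EuclideanSpace ℝ (Fin 2) := fun n => p ⟨min n H, by omega⟩ with hP
  have hPval (t : Fin (H + 1)) : P t = p t := by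
    simp only [hP]
    congr 1
    ext
    simp only [inf_eq_left]
    omega
  have hPH : P H = xstar := by simpa [hend] using hPval (Fin.last H)
  have hPfeas (n : ℕ) (hn : n < H) : segment ℝ (P n) (P (n + 1)) ⊆ Ω := by
    have h := hfeas ⟨n, hn⟩
    rwa [← hPval, ← hPval] at h
  have hsum : ∑ t : Fin H, dist (p t.castSucc) (p t.succ) =
      ∑ n ∈ Finset.range H, dist (P n) (P (n + 1)) := by
    rw [Finset.sum_range]
    refine Finset.sum_congr rfl fun t _ => ?_
    rw [← hPval, ← hPval, Fin.val_castSucc, Fin.val_succ]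
  have hjH : (j : ℕ) ≤ H := by omega
  have hiH : (i : ℕ) ≤ H := by omega
  have hji' : (j : ℕ) ≤ i := hji
  -- The competitor follows `p` up to `p j` and then goes straight to the target.
  set Q : ℕ → EuclideanSpace ℝ (Fin 2) := fun n => if n ≤ j then P n else xstar with hQ
  have hQle (n : ℕ) (hn : n ≤ j) : Q n = P n := if_pos hn
  have hQlast : Q (j + 1) = xstar := if_neg (by omega)
  have hcomp := hshort (j + 1) (by omega) (fun t => Q t)
    (fun t => by
      rw [Fin.val_castSucc, Fin.val_succ]
      rcases Nat.lt_succ_iff_lt_or_eq.mp t.isLt with h | h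
      · rw [hQle _ h.le, hQle _ h]
        exact hPfeas _ (by omega)
      · rw [h, hQle _ le_rfl, hQlast, hPval]
        exact hlos)
    (by simpa [hQle 0 (Nat.zero_le _)] using hPval 0)
    (by simpa using hQlast)
  have hQsum : ∑ t : Fin (j + 1), dist (Q t.castSucc) (Q t.succ) =
      ∑ n ∈ Finset.range j, dist (P n) (P (n + 1)) + dist (P j) xstar := by
    simp only [Fin.val_castSucc, Fin.val_succ]
    rw [← Finset.sum_range (fun n => dist (Q n) (Q (n + 1))), Finset.sum_range_succ,
      hQle _ le_rfl, hQlast]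
    congr 1
    refine Finset.sum_congr rfl fun n hn => ?_
    have hn := Finset.mem_range.mp hn
    rw [hQle _ hn.le, hQle _ hn]
  rw [hsum, hQsum, ← Finset.sum_range_add_sum_Ico _ hjH,
    ← Finset.sum_Ico_consecutive _ hji' hiH] at hcomp
  have h₁ := dist_le_Ico_sum_dist P hji'
  have h₂ := dist_le_Ico_sum_dist P hiH
  rw [hPH] at h₂
  simp only [hPval] at h₁ h₂ hcomp
  have hmem : p i ∈ segment ℝ (p j) xstar := by
    rw [mem_segment_iff_wbtw, ← dist_add_dist_eq_iff]
    exact le_antisymm (by linarith) (dist_triangle _ _ _)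
  exact ((convex_segment _ _).segment_subset hmem (right_mem_segment ℝ _ _)).trans hlos
end

section
/- Let α be a type (the set of poses/states) and let ℓ : α → ℝ be a link-state function that is not constant (there exist a, b ∈ α with ℓ(a) ≠ ℓ(b)). Then the link-state shaping cost c(s, s') = max 0 (ℓ(s') − ℓ(s)) is not potential-based: there is no function φ : α → ℝ such that max 0 (ℓ(s') − ℓ(s)) = φ(s') − φ(s) for all s, s' ∈ α. -/
/-- If the link-state function `ℓ` is not constant, then the shaping cost
`c(s, s') = max 0 (ℓ s' - ℓ s)` is not potential-based: no potential `φ`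
satisfies `c(s, s') = φ s' - φ s` for all `s, s'`. -/
theorem link_state_cost_not_potential_based {α : Type*} (ℓ : α → ℝ)
    (hnc : ∃ a b : α, ℓ a ≠ ℓ b) :
    ¬ ∃ φ : α → ℝ, ∀ s s' : α, max 0 (ℓ s' - ℓ s) = φ s' - φ s := by
  rintro ⟨φ, hφ⟩
  obtain ⟨a, b, hab⟩ := hnc
  have key : ∀ s s' : α, ℓ s' ≤ ℓ s := fun s s' => by
    linarith [hφ s s', hφ s' s, le_max_right 0 (ℓ s' - ℓ s), le_max_left 0 (ℓ s - ℓ s')]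
  exact hab (le_antisymm (key b a) (key a b))
end
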